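/- arXiv:2007.01431 — 10 statements merged into one kernel-verified Lean document; each statement's English description precedes it below -/
import Mathlib

section
/- A connected finite simple graph G admits a gap-vertex-labelling if and only if G admits a gap-vertex-labelling (π', c_{π'}) in which the labelling π' is injective, i.e. π'(u) ≠ π'(v) for every pair of distinct vertices u, v of G. -/
/-- The neighbourhood of `v` in `G` as a `Finset` (classically decidable). -/
noncomputable def gapNbhd {V : Type*} [Fintype V] (G : SimpleGraph V) (v : V) : Finset V :=
  @Finset.filter V (fun u => G.Adj v u) (Classical.decPred _) Finset.univ

/-- The colouring induced by a vertex-labelling `π` : a vertex with at least two neighbours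
gets the gap `max − min` of the labels of its neighbours, a vertex with exactly one neighbour
`u` gets `π u`, and an isolated vertex gets `1`. -/
noncomputable def gapColor {V : Type*} [Fintype V] (G : SimpleGraph V) (π : V → ℕ) (v : V) : ℕ :=
  if h : ((gapNbhd G v).image π).Nonempty then
    if 2 ≤ (gapNbhd G v).card then
      ((gapNbhd G v).image π).max' h - ((gapNbhd G v).image π).min' h
    else ((gapNbhd G v).image π).max' h
  else 1

/-- `π` is a gap-`[k]`-vertex-labelling of `G`: the labels lie in `{1, …, k}` and the induced
colouring is proper. -/
def IsGapLabelling {V : Type*} [Fintype V] (G : SimpleGraph V) (k : ℕ) (π : V → ℕ) : Prop :=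
  (∀ v, 1 ≤ π v ∧ π v ≤ k) ∧
  ∀ u v, G.Adj u v → gapColor G π u ≠ gapColor G π v

/-- `G` is gap-vertex-labelable if it admits a gap-`[k]`-vertex-labelling for some `k ≥ 1`. -/
def GapVertexLabelable {V : Type*} [Fintype V] (G : SimpleGraph V) : Prop :=
  ∃ k, 1 ≤ k ∧ ∃ π, IsGapLabelling G k π

/-- The vertex-gap number: the least `k ≥ 1` for which `G` admits a
gap-`[k]`-vertex-labelling. -/
noncomputable def vertexGapNumber {V : Type*} [Fintype V] (G : SimpleGraph V) : ℕ :=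
  sInf {k | 1 ≤ k ∧ ∃ π, IsGapLabelling G k π}

/-- Scaling a labelling by `M` and perturbing it by less than `n` scales every gap by `M`, up to an
error less than `n`. -/
theorem gapColor_mul_add {V : Type*} [Fintype V] (G : SimpleGraph V) (π ε : V → ℕ) (M n : ℕ)
    (hε : ∀ v, ε v < n) {u v : V} (huv : G.Adj u v) :
    gapColor G (fun w => M * π w + ε w) u < M * gapColor G π u + n ∧
      M * gapColor G π u < gapColor G (fun w => M * π w + ε w) u + n := by
  have hne : (gapNbhd G u).Nonempty := ⟨v, by simpa [gapNbhd] using huv⟩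
  have h (f : V → ℕ) : ((gapNbhd G u).image f).Nonempty := hne.image f
  set π' : V → ℕ := fun w => M * π w + ε w with hπ'
  obtain ⟨a, ha, ha'⟩ := Finset.mem_image.1 (Finset.max'_mem _ (h π))
  obtain ⟨b, hb, hb'⟩ := Finset.mem_image.1 (Finset.min'_mem _ (h π))
  obtain ⟨c, hc, hc'⟩ := Finset.mem_image.1 (Finset.max'_mem _ (h π'))
  obtain ⟨d, hd, hd'⟩ := Finset.mem_image.1 (Finset.min'_mem _ (h π'))
  have hca : π c ≤ π a := ha' ▸ Finset.le_max' _ _ (Finset.mem_image_of_mem π hc)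
  have hbd : π b ≤ π d := hb' ▸ Finset.min'_le _ _ (Finset.mem_image_of_mem π hd)
  have hba : π b ≤ π a := ha' ▸ Finset.le_max' _ _ (Finset.mem_image_of_mem π hb)
  have hac : π' a ≤ π' c := hc' ▸ Finset.le_max' _ _ (Finset.mem_image_of_mem π' ha)
  have hdb : π' d ≤ π' b := hd' ▸ Finset.min'_le _ _ (Finset.mem_image_of_mem π' hb)
  have hdc : π' d ≤ π' c := hc' ▸ Finset.le_max' _ _ (Finset.mem_image_of_mem π' hd)
  simp only [gapColor, dif_pos (h _), ← ha', ← hb', ← hc', ← hd']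
  have hca := Nat.mul_le_mul_left M hca
  have hbd := Nat.mul_le_mul_left M hbd
  have hba := Nat.mul_le_mul_left M hba
  have := hε a
  have := hε b
  have := hε c
  have := hε d
  simp only [hπ'] at hac hdb hdc ⊢
  split_ifs
  · rw [Nat.mul_sub]
    omega
  · omega

/-- A connected finite simple graph admits a gap-vertex-labelling iff it admits one in which
the labelling is injective. -/
theorem connected_gapVertexLabelable_iff_injective
    {V : Type*} [Fintype V] (G : SimpleGraph V) (hG : G.Connected) :
    GapVertexLabelable G ↔
      ∃ k, 1 ≤ k ∧ ∃ π, IsGapLabelling G k π ∧ Function.Injective π := by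
  refine ⟨?_, fun ⟨k, hk, π, hπ, _⟩ => ⟨k, hk, π, hπ⟩⟩
  rintro ⟨k, hk, π, hπ, hc⟩
  set n := Fintype.card V
  have hn : 0 < n := Fintype.card_pos_iff.2 hG.nonempty
  let e : V ≃ Fin n := Fintype.equivFin V
  refine ⟨2 * n * k + n, by omega, fun v => 2 * n * π v + e v,
    ⟨fun v => ⟨?_, ?_⟩, fun u v huv heq => ?_⟩, fun u v huv => ?_⟩
  · have := Nat.mul_le_mul_left (2 * n) (hπ v).1
    dsimp only
    omega
  · have := Nat.mul_le_mul_left (2 * n) (hπ v).2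
    have := (e v).isLt
    dsimp only
    omega
  · have hu := gapColor_mul_add G π (fun v => e v) (2 * n) n (fun v => (e v).isLt) huv
    have hv := gapColor_mul_add G π (fun v => e v) (2 * n) n (fun v => (e v).isLt) huv.symm
    rcases lt_or_gt_of_ne (hc u v huv) with h | h
    · have := Nat.mul_le_mul_left (2 * n) (Nat.succ_le_of_lt h)
      rw [Nat.mul_succ] at this
      omega
    · have := Nat.mul_le_mul_left (2 * n) (Nat.succ_le_of_lt h)
      rw [Nat.mul_succ] at this
      omega
  · have hlt (w : V) : (e w : ℕ) < 2 * n := by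
      have := (e w).isLt
      omega
    have := congrArg (· % (2 * n)) huv
    simp only [Nat.mul_add_mod, Nat.mod_eq_of_lt (hlt _)] at this
    exact e.injective (Fin.ext this)
end

section
/- If a connected finite simple graph G on n vertices is gap-vertex-labelable, then G admits a gap-vertex-labelling whose labels are all powers of two not exceeding 2^{n−1}; in particular, G admits a gap-[2^{n−1}]-vertex-labelling, so the vertex-gap number of G is at most 2^{n−1}. -/
theorem not_two_pow_add_eq_of_lt {i a b c : ℕ} (ha : i < a) (hb : i < b) (hc : i < c) :
    2 ^ a + 2 ^ i ≠ 2 ^ b + 2 ^ c := by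
  intro h
  have hdvd : ∀ {x : ℕ}, i < x → 2 ^ (i + 1) ∣ 2 ^ x := fun hx => pow_dvd_pow 2 hx
  have h₁ : 2 ^ (i + 1) ∣ 2 ^ i :=
    (Nat.dvd_add_right (hdvd ha)).1 (h ▸ dvd_add (hdvd hb) (hdvd hc))
  have h₂ := (Nat.pow_dvd_pow_iff_le_right (by norm_num : 1 < 2)).1 h₁
  omega

theorem two_pow_sub_two_pow_inj {a b c d : ℕ} (hba : b < a) (hdc : d < c)
    (h : 2 ^ a - 2 ^ b = 2 ^ c - 2 ^ d) : a = c ∧ b = d := by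
  have hab : 2 ^ b < 2 ^ a := Nat.pow_lt_pow_right (by norm_num) hba
  have hcd : 2 ^ d < 2 ^ c := Nat.pow_lt_pow_right (by norm_num) hdc
  have hbd : b = d := by
    rcases lt_trichotomy b d with hlt | heq | hlt
    · exact absurd (by omega) (not_two_pow_add_eq_of_lt (hlt.trans hdc) hba hlt)
    · exact heq
    · exact absurd (by omega) (not_two_pow_add_eq_of_lt (hlt.trans hba) hdc hlt)
  subst hbd
  exact ⟨Nat.pow_right_injective le_rfl (by dsimp only; omega), rfl⟩

theorem eq_of_two_pow_sub_two_pow_eq_two_pow {a b i : ℕ} (hba : b < a)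
    (h : 2 ^ a - 2 ^ b = 2 ^ i) : i = b := by
  have hab : 2 ^ b < 2 ^ a := Nat.pow_lt_pow_right (by norm_num) hba
  have hs : 2 ^ (i + 1) = 2 * 2 ^ i := by ring
  exact (two_pow_sub_two_pow_inj hba i.lt_succ_self (by rw [Nat.succ_eq_add_one]; omega)).2.symm

section

variable {V : Type*} [Fintype V] {G : SimpleGraph V}

theorem mem_gapNbhd {u v : V} : u ∈ gapNbhd G v ↔ G.Adj v u := by
  simp [gapNbhd]

theorem gapColor_eq_sub {π : V → ℕ} {v m M : V} (hm : G.Adj v m) (hM : G.Adj v M) (hne : m ≠ M)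
    (hmin : ∀ x, G.Adj v x → π m ≤ π x) (hmax : ∀ x, G.Adj v x → π x ≤ π M) :
    gapColor G π v = π M - π m := by
  have hmem : ∀ {x}, G.Adj v x → π x ∈ (gapNbhd G v).image π := fun hx =>
    Finset.mem_image_of_mem π (mem_gapNbhd.2 hx)
  have hcard : 2 ≤ (gapNbhd G v).card :=
    Finset.one_lt_card.2 ⟨m, mem_gapNbhd.2 hm, M, mem_gapNbhd.2 hM, hne⟩
  rw [gapColor, dif_pos ⟨_, hmem hm⟩, if_pos hcard]
  congr 1
  · refine le_antisymm (Finset.max'_le _ _ _ ?_) (Finset.le_max' _ _ (hmem hM))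
    simpa [mem_gapNbhd] using hmax
  · refine le_antisymm (Finset.min'_le _ _ (hmem hm)) (Finset.le_min' _ _ _ ?_)
    simpa [mem_gapNbhd] using hmin

theorem gapColor_eq_of_unique {π : V → ℕ} {v m : V} (hm : G.Adj v m)
    (huniq : ∀ x, G.Adj v x → x = m) : gapColor G π v = π m := by
  have hN : gapNbhd G v = {m} := by
    ext x
    rw [mem_gapNbhd, Finset.mem_singleton]
    exact ⟨huniq x, fun hx => hx ▸ hm⟩
  simp [gapColor, hN]

/-- Any two labellings that are weakly increasing in an injective ranking `r` have, at a
non-isolated vertex, colours read off from the same extremal neighbours. -/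
theorem exists_extremal_neighbours {r : V → ℕ} (hr : Function.Injective r) {v w : V}
    (hvw : G.Adj v w) :
    (∀ x, G.Adj v x → x = w) ∨
      ∃ m M, G.Adj v m ∧ r m < r M ∧
        ∀ π : V → ℕ, (∀ x y, r x ≤ r y → π x ≤ π y) → gapColor G π v = π M - π m := by
  have hne : (gapNbhd G v).Nonempty := ⟨w, mem_gapNbhd.2 hvw⟩
  obtain ⟨m, hm, hmin⟩ := Finset.exists_min_image _ r hne
  obtain ⟨M, hM, hmax⟩ := Finset.exists_max_image _ r hne
  simp only [mem_gapNbhd] at hm hM hmin hmax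
  by_cases h : m = M
  · subst h
    have huniq : ∀ x, G.Adj v x → x = m := fun x hx =>
      hr (le_antisymm (hmax x hx) (hmin x hx))
    exact Or.inl fun x hx => (huniq x hx).trans (huniq w hvw).symm
  · exact Or.inr ⟨m, M, hm, lt_of_le_of_ne (hmin M hM) (hr.ne h), fun π hπ =>
      gapColor_eq_sub hm hM h (fun x hx => hπ _ _ (hmin x hx)) fun x hx => hπ _ _ (hmax x hx)⟩

theorem gapColor_two_pow_ne {r : V → ℕ} (hr : Function.Injective r) {π : V → ℕ}
    (hπ : ∀ x y, r x ≤ r y → π x ≤ π y) {u v : V} (huv : G.Adj u v)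
    (hne : gapColor G π u ≠ gapColor G π v) :
    gapColor G (fun x => 2 ^ r x) u ≠ gapColor G (fun x => 2 ^ r x) v := by
  have hmono : ∀ x y, r x ≤ r y → 2 ^ r x ≤ 2 ^ r y := fun _ _ h =>
    Nat.pow_le_pow_right (by norm_num) h
  intro heq
  rcases exists_extremal_neighbours hr huv with hu | ⟨m, M, hm, hmM, hu⟩ <;>
    rcases exists_extremal_neighbours hr huv.symm with hv | ⟨m', M', hm', hmM', hv⟩
  · rw [gapColor_eq_of_unique huv hu, gapColor_eq_of_unique huv.symm hv] at heq
    exact huv.ne' (hr (Nat.pow_right_injective le_rfl heq))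
  · rw [gapColor_eq_of_unique huv hu, hv _ hmono] at heq
    exact hm'.ne (hr (eq_of_two_pow_sub_two_pow_eq_two_pow hmM' heq.symm))
  · rw [gapColor_eq_of_unique huv.symm hv, hu _ hmono] at heq
    exact hm.ne (hr (eq_of_two_pow_sub_two_pow_eq_two_pow hmM heq))
  · rw [hu _ hmono, hv _ hmono] at heq
    obtain ⟨hM, hm⟩ := two_pow_sub_two_pow_inj hmM hmM' heq
    rw [hu π hπ, hv π hπ, hr hM, hr hm] at hne
    exact hne rfl

/-- The vertices can be ranked by `0, …, n - 1` compatibly with a given labelling. -/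
theorem exists_injective_ranking (π : V → ℕ) :
    ∃ r : V → ℕ, Function.Injective r ∧ (∀ v, r v ≤ Fintype.card V - 1) ∧
      ∀ x y, r x ≤ r y → π x ≤ π y := by
  let e := Fintype.equivFin V
  let s := Tuple.sort (π ∘ e.symm)
  have hs : Monotone ((π ∘ e.symm) ∘ s) := Tuple.monotone_sort _
  refine ⟨fun v => s.symm (e v), fun x y h => ?_, fun v => Nat.le_sub_one_of_lt (Fin.is_lt _),
    fun x y h => ?_⟩
  · simpa using Fin.ext h
  · simpa using hs (Fin.le_def.2 h)

end

/-- If a connected graph on `n` vertices is gap-vertex-labelable, then it admits a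
gap-vertex-labelling all of whose labels are powers of two not exceeding `2 ^ (n - 1)`;
in particular it admits a gap-`[2 ^ (n - 1)]`-vertex-labelling, so its vertex-gap number is
at most `2 ^ (n - 1)`. -/
theorem vertexGapNumber_le_two_pow
    {V : Type*} [Fintype V] (G : SimpleGraph V) (hG : G.Connected)
    (h : GapVertexLabelable G) :
    (∃ π, IsGapLabelling G (2 ^ (Fintype.card V - 1)) π ∧
        ∀ v, ∃ i, i ≤ Fintype.card V - 1 ∧ π v = 2 ^ i) ∧
      vertexGapNumber G ≤ 2 ^ (Fintype.card V - 1) := by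
  obtain ⟨-, -, π, -, hπ⟩ := h
  obtain ⟨r, hr, hle, hmono⟩ := exists_injective_ranking π
  have hlab : IsGapLabelling G (2 ^ (Fintype.card V - 1)) fun v => 2 ^ r v :=
    ⟨fun v => ⟨Nat.one_le_two_pow, Nat.pow_le_pow_right (by norm_num) (hle v)⟩,
      fun u v huv => gapColor_two_pow_ne hr hmono huv (hπ u v huv)⟩
  exact ⟨⟨_, hlab, fun v => ⟨r v, hle v, rfl⟩⟩, Nat.sInf_le ⟨Nat.one_le_two_pow, _, hlab⟩⟩
end

section
/- If a connected finite simple graph G on n ≥ 1 vertices is gap-vertex-labelable, then G admits a gap-[16n²]-vertex-labelling; hence the vertex-gap number of a gap-vertex-labelable graph on n vertices is O(n²). -/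
/-- A nontrivial equation between two sums of two values of `f`, in which `x` occurs, holds for at
most one choice of the value at `x`. -/
theorem update_add_eq_unique {f : ℕ → ℕ} {T : Set ℕ} (hf : Set.InjOn f T) {a b c d x y z : ℕ}
    (ha : a ≠ x → a ∈ T) (hb : b ≠ x → b ∈ T) (hc : c ≠ x → c ∈ T) (hd : d ≠ x → d ∈ T)
    (hx : ¬ (a ≠ x ∧ b ≠ x ∧ c ≠ x ∧ d ≠ x)) (hne : a + b ≠ c + d)
    (hy : Function.update f x y a + Function.update f x y b =
      Function.update f x y c + Function.update f x y d)
    (hz : Function.update f x z a + Function.update f x z b =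
      Function.update f x z c + Function.update f x z d) : y = z := by
  have hac (h1 : a ≠ x) (h2 : c ≠ x) (h : f a = f c) : a = c := hf (ha h1) (hc h2) h
  have had (h1 : a ≠ x) (h2 : d ≠ x) (h : f a = f d) : a = d := hf (ha h1) (hd h2) h
  have hbc (h1 : b ≠ x) (h2 : c ≠ x) (h : f b = f c) : b = c := hf (hb h1) (hc h2) h
  have hbd (h1 : b ≠ x) (h2 : d ≠ x) (h : f b = f d) : b = d := hf (hb h1) (hd h2) h
  clear ha hb hc hd hf
  simp only [Function.update_apply] at hy hz
  by_cases h1 : a = x <;> by_cases h2 : b = x <;> by_cases h3 : c = x <;> by_cases h4 : d = x <;>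
    simp only [h1, h2, h3, h4, if_true, if_false, ne_eq, not_true, not_false_iff,
      true_implies, false_implies, and_true, and_false] at * <;> omega

/-- Values `f x` for `x` in a finite set of positive integers can be chosen greedily, in increasing
order, so that finitely many differences `f (a u) - f (b u)` and `f (a v) - f (b v)` which are
distinct for the identity stay distinct for `f`; every constraint costs at most one value. -/
theorem exists_strictMonoOn_of_differences_ne {ι : Type*} (a b : ι → ℕ) (S : Finset ℕ)
    (hS : ∀ x ∈ S, 0 < x) (D : Finset (ι × ι))
    (hD : ∀ p ∈ D, a p.1 ∈ insert 0 S ∧ b p.1 ∈ insert 0 S ∧ a p.2 ∈ insert 0 S ∧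
      b p.2 ∈ insert 0 S ∧ a p.1 + b p.2 ≠ a p.2 + b p.1) :
    ∃ f : ℕ → ℕ, f 0 = 0 ∧ StrictMonoOn f (insert 0 S : Finset ℕ) ∧
      (∀ x ∈ insert 0 S, f x ≤ S.card + D.card) ∧
      ∀ p ∈ D, f (a p.1) + f (b p.2) ≠ f (a p.2) + f (b p.1) := by
  classical
  induction S using Finset.induction_on_max generalizing D with
  | empty =>
    refine ⟨fun _ => 0, rfl, by simp [StrictMonoOn], by simp, fun p hp => ?_⟩
    have := hD p hp
    simp only [insert_empty_eq, Finset.mem_singleton] at this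
    omega
  | insert x S hx ih =>
    have hxS : x ∉ insert 0 S := by
      have := hS x (Finset.mem_insert_self _ _)
      intro h
      rcases Finset.mem_insert.1 h with h | h
      · omega
      · exact (hx x h).false
    let old : ι × ι → Prop := fun p =>
      a p.1 ≠ x ∧ b p.1 ≠ x ∧ a p.2 ≠ x ∧ b p.2 ≠ x
    have mem_of_ne {z : ℕ} (hz : z ∈ insert 0 (insert x S)) (hne : z ≠ x) : z ∈ insert 0 S := by
      simp only [Finset.mem_insert] at hz ⊢
      tauto
    obtain ⟨f, hf0, hf, hfB, hfD⟩ := ih (fun y hy => hS y (Finset.mem_insert_of_mem hy))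
      (D.filter old) (fun p hp => by
        obtain ⟨hp, h1, h2, h3, h4⟩ := Finset.mem_filter.1 hp
        obtain ⟨k1, k2, k3, k4, k5⟩ := hD p hp
        exact ⟨mem_of_ne k1 h1, mem_of_ne k2 h2, mem_of_ne k3 h3, mem_of_ne k4 h4, k5⟩)
    set B := S.card + (D.filter old).card with hB
    let bad : ℕ → ι × ι → Prop := fun y p =>
      Function.update f x y (a p.1) + Function.update f x y (b p.2) =
        Function.update f x y (a p.2) + Function.update f x y (b p.1)
    have bad_unique {p : ι × ι} (hp : p ∈ D) (hpo : ¬ old p) {y z : ℕ} (hy : bad y p)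
        (hz : bad z p) : y = z := by
      obtain ⟨k1, k2, k3, k4, k5⟩ := hD p hp
      refine update_add_eq_unique hf.injOn (fun h => mem_of_ne k1 h) (fun h => mem_of_ne k4 h)
        (fun h => mem_of_ne k3 h) (fun h => mem_of_ne k2 h) (fun h => hpo ?_) k5 hy hz
      exact ⟨h.1, h.2.2.2, h.2.2.1, h.2.1⟩
    obtain ⟨y, hyB, hyB', hy⟩ : ∃ y, B < y ∧ y ≤ B + 1 + (D.filter (¬ old ·)).card ∧
        ∀ p ∈ D.filter (¬ old ·), ¬ bad y p := by
      by_contra! hcon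
      have hle := Finset.card_le_card_of_forall_subsingleton bad
        (s := Finset.Ioc B (B + 1 + (D.filter (¬ old ·)).card)) (t := D.filter (¬ old ·))
        (fun y hy => hcon y (Finset.mem_Ioc.1 hy).1 (Finset.mem_Ioc.1 hy).2)
        (fun p hp y hy z hz => bad_unique (Finset.mem_filter.1 hp).1 (Finset.mem_filter.1 hp).2
          hy.2 hz.2)
      rw [Nat.card_Ioc] at hle
      omega
    have hcard : (D.filter old).card + (D.filter (¬ old ·)).card = D.card :=
      Finset.card_filter_add_card_filter_not old
    have hSx : (insert x S).card = S.card + 1 :=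
      Finset.card_insert_of_notMem fun h => hxS (Finset.mem_insert_of_mem h)
    have hx0 : 0 < x := hS x (Finset.mem_insert_self _ _)
    have le_x {z : ℕ} (hz : z ∈ insert 0 (insert x S)) : z ≤ x := by
      rcases Finset.mem_insert.1 hz with rfl | hz
      · omega
      · rcases Finset.mem_insert.1 hz with rfl | hz
        · exact le_rfl
        · exact (hx z hz).le
    refine ⟨Function.update f x y, by rw [Function.update_of_ne hx0.ne, hf0], ?_, ?_, ?_⟩
    · intro s hs t ht hst
      have hs' := Finset.mem_coe.1 hs
      have ht' := Finset.mem_coe.1 ht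
      have hsx : s ≠ x := (hst.trans_le (le_x ht')).ne
      rw [Function.update_of_ne hsx]
      by_cases htx : t = x
      · subst htx
        rw [Function.update_self]
        exact (hfB s (mem_of_ne hs' hsx)).trans_lt hyB
      · rw [Function.update_of_ne htx]
        exact hf (mem_of_ne hs' hsx) (mem_of_ne ht' htx) hst
    · intro z hz
      by_cases hzx : z = x
      · subst hzx
        rw [Function.update_self]
        omega
      · rw [Function.update_of_ne hzx]
        have := hfB z (mem_of_ne hz hzx)
        omega
    · intro p hp
      by_cases hpo : old p
      · have := hfD p (Finset.mem_filter.2 ⟨hp, hpo⟩)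
        obtain ⟨h1, h2, h3, h4⟩ := hpo
        simpa only [Function.update_of_ne h1, Function.update_of_ne h2,
          Function.update_of_ne h3, Function.update_of_ne h4] using this
      · exact hy p (Finset.mem_filter.2 ⟨hp, hpo⟩)

/-- The colour of a non-isolated vertex is a difference of two labels (or of a label and `0`), and
this expression persists under relabelling by a monotone map fixing `0`. -/
theorem exists_gapColor_comp_eq_sub {V : Type*} [Fintype V] (G : SimpleGraph V) (π : V → ℕ)
    {v : V} (hv : (gapNbhd G v).Nonempty) :
    ∃ a ∈ insert 0 (Finset.univ.image π), ∃ b ∈ insert 0 (Finset.univ.image π), b ≤ a ∧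
      ∀ f : ℕ → ℕ, f 0 = 0 → MonotoneOn f (insert 0 (Finset.univ.image π) : Finset ℕ) →
        gapColor G (f ∘ π) v = f a - f b := by
  have hne : ((gapNbhd G v).image π).Nonempty := hv.image π
  have hsub : (gapNbhd G v).image π ⊆ insert 0 (Finset.univ.image π) :=
    (Finset.image_subset_image (Finset.subset_univ _)).trans (Finset.subset_insert _ _)
  have hmax {f : ℕ → ℕ} (hf : MonotoneOn f (insert 0 (Finset.univ.image π) : Finset ℕ))
      (h : ((gapNbhd G v).image (f ∘ π)).Nonempty) :
      ((gapNbhd G v).image (f ∘ π)).max' h = f (((gapNbhd G v).image π).max' hne) := by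
    refine le_antisymm (Finset.max'_le _ _ _ fun y hy => ?_) (Finset.le_max' _ _ ?_)
    · obtain ⟨u, hu, rfl⟩ := Finset.mem_image.1 hy
      have hu := Finset.mem_image_of_mem π hu
      exact hf (hsub hu) (hsub (Finset.max'_mem _ hne)) (Finset.le_max' _ _ hu)
    · rw [← Finset.image_image]
      exact Finset.mem_image_of_mem f (Finset.max'_mem _ hne)
  have hmin {f : ℕ → ℕ} (hf : MonotoneOn f (insert 0 (Finset.univ.image π) : Finset ℕ))
      (h : ((gapNbhd G v).image (f ∘ π)).Nonempty) :
      ((gapNbhd G v).image (f ∘ π)).min' h = f (((gapNbhd G v).image π).min' hne) := by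
    refine le_antisymm (Finset.min'_le _ _ ?_) (Finset.le_min' _ _ _ fun y hy => ?_)
    · rw [← Finset.image_image]
      exact Finset.mem_image_of_mem f (Finset.min'_mem _ hne)
    · obtain ⟨u, hu, rfl⟩ := Finset.mem_image.1 hy
      have hu := Finset.mem_image_of_mem π hu
      exact hf (hsub (Finset.min'_mem _ hne)) (hsub hu) (Finset.min'_le _ _ hu)
  by_cases h2 : 2 ≤ (gapNbhd G v).card
  · refine ⟨_, hsub (Finset.max'_mem _ hne), _, hsub (Finset.min'_mem _ hne),
      Finset.min'_le _ _ (Finset.max'_mem _ hne), fun f _ hf => ?_⟩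
    rw [gapColor, dif_pos (hv.image _), if_pos h2, hmax hf, hmin hf]
  · refine ⟨_, hsub (Finset.max'_mem _ hne), 0, Finset.mem_insert_self _ _, Nat.zero_le _,
      fun f hf0 hf => ?_⟩
    rw [gapColor, dif_pos (hv.image _), if_neg h2, hmax hf, hf0, Nat.sub_zero]

/-- A gap-vertex-labelable graph on `n` vertices has a gap-`[n + n²]`-vertex-labelling. -/
theorem GapVertexLabelable.exists_isGapLabelling {V : Type*} [Fintype V] {G : SimpleGraph V}
    (h : GapVertexLabelable G) :
    ∃ π, IsGapLabelling G (Fintype.card V + Fintype.card V ^ 2) π := by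
  classical
  obtain ⟨k, -, π, hπ, hc⟩ := h
  have key (v : V) : ∃ p : ℕ × ℕ, (gapNbhd G v).Nonempty →
      p.1 ∈ insert 0 (Finset.univ.image π) ∧ p.2 ∈ insert 0 (Finset.univ.image π) ∧ p.2 ≤ p.1 ∧
      ∀ f : ℕ → ℕ, f 0 = 0 → MonotoneOn f (insert 0 (Finset.univ.image π) : Finset ℕ) →
        gapColor G (f ∘ π) v = f p.1 - f p.2 := by
    by_cases hv : (gapNbhd G v).Nonempty
    · obtain ⟨a, ha, b, hb, hab, H⟩ := exists_gapColor_comp_eq_sub G π hv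
      exact ⟨(a, b), fun _ => ⟨ha, hb, hab, H⟩⟩
    · exact ⟨0, fun h => absurd h hv⟩
  choose p hp using key
  have hnbhd {u v : V} (huv : G.Adj u v) : (gapNbhd G u).Nonempty := ⟨v, by simpa [gapNbhd]⟩
  let D : Finset (V × V) := Finset.univ.filter fun e => G.Adj e.1 e.2
  obtain ⟨f, hf0, hf, hfB, hfD⟩ := exists_strictMonoOn_of_differences_ne
    (fun v => (p v).1) (fun v => (p v).2) (Finset.univ.image π)
    (fun x hx => by
      obtain ⟨v, -, rfl⟩ := Finset.mem_image.1 hx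
      exact (hπ v).1) D
    (fun e he => by
      have hadj : G.Adj e.1 e.2 := (Finset.mem_filter.1 he).2
      obtain ⟨a1, b1, l1, c1⟩ := hp e.1 (hnbhd hadj)
      obtain ⟨a2, b2, l2, c2⟩ := hp e.2 (hnbhd hadj.symm)
      have hne := hc _ _ hadj
      have d1 := c1 id rfl monotoneOn_id
      have d2 := c2 id rfl monotoneOn_id
      simp only [Function.id_comp, id] at d1 d2
      exact ⟨a1, b1, a2, b2, by omega⟩)
  have hmem (v : V) : π v ∈ insert 0 (Finset.univ.image π) :=
    Finset.mem_insert_of_mem (Finset.mem_image_of_mem π (Finset.mem_univ v))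
  refine ⟨f ∘ π, fun v => ⟨?_, (hfB _ (hmem v)).trans ?_⟩, fun u v huv => ?_⟩
  · have := hf (Finset.mem_insert_self _ _) (hmem v) (hπ v).1
    exact Nat.one_le_iff_ne_zero.2 (by simpa [hf0, Nat.pos_iff_ne_zero] using this)
  · have hS : (Finset.univ.image π).card ≤ Fintype.card V := Finset.card_image_le
    have hD : D.card ≤ Fintype.card V ^ 2 := by
      rw [sq, ← Fintype.card_prod]
      exact Finset.card_le_univ D
    exact Nat.add_le_add hS hD
  · obtain ⟨a1, b1, l1, c1⟩ := hp u (hnbhd huv)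
    obtain ⟨a2, b2, l2, c2⟩ := hp v (hnbhd huv.symm)
    have hne := hfD (u, v) (Finset.mem_filter.2 ⟨Finset.mem_univ _, huv⟩)
    rw [c1 f hf0 hf.monotoneOn, c2 f hf0 hf.monotoneOn]
    have m1 := hf.monotoneOn b1 a1 l1
    have m2 := hf.monotoneOn b2 a2 l2
    dsimp only at hne
    omega

theorem IsGapLabelling.mono {V : Type*} [Fintype V] {G : SimpleGraph V} {k l : ℕ} {π : V → ℕ}
    (h : IsGapLabelling G k π) (hkl : k ≤ l) : IsGapLabelling G l π :=
  ⟨fun v => ⟨(h.1 v).1, (h.1 v).2.trans hkl⟩, h.2⟩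

/-- If a connected graph on `n ≥ 1` vertices is gap-vertex-labelable, then it admits a
gap-`[16 n²]`-vertex-labelling; hence its vertex-gap number is `O(n²)`. -/
theorem vertexGapNumber_quadratic
    {V : Type*} [Fintype V] (G : SimpleGraph V) (hG : G.Connected)
    (hn : 1 ≤ Fintype.card V) (h : GapVertexLabelable G) :
    (∃ π, IsGapLabelling G (16 * Fintype.card V ^ 2) π) ∧
      vertexGapNumber G ≤ 16 * Fintype.card V ^ 2 := by
  obtain ⟨π, hπ⟩ := h.exists_isGapLabelling
  have hπ' := hπ.mono (l := 16 * Fintype.card V ^ 2) (by nlinarith)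
  exact ⟨⟨π, hπ'⟩, Nat.sInf_le ⟨by nlinarith, π, hπ'⟩⟩
end

section
/- Let L : ℕ → ℝ be defined by L(n) = 0 for n ≤ 3 and, for n ≥ 4, L(n) = min over all natural numbers x, i with x + i = n − 2 of the quantity x + i(i−1)/2 + L(x+1). Then L(n) ≥ (1/10)·n^{3/2} for all n ≥ 4; in particular L(n) ∈ Ω(n^{3/2}). -/
theorem Real.rpow_three_halves_eq_sqrt_pow {x : ℝ} (hx : 0 ≤ x) :
    x ^ ((3 : ℝ) / 2) = √x ^ 3 := by
  rw [Real.sqrt_eq_rpow, ← Real.rpow_natCast, ← Real.rpow_mul hx]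
  norm_num

theorem Real.rpow_three_halves_le_quadratic {n : ℝ} (hn : 0 ≤ n) :
    n ^ ((3 : ℝ) / 2) ≤ n * (n + 4) / 4 := by
  rw [Real.rpow_three_halves_eq_sqrt_pow hn]
  have hsq := Real.sq_sqrt hn
  calc √n ^ 3 = n * √n := by rw [pow_succ, hsq]
    _ ≤ n * ((n + 4) / 4) := by
      gcongr
      nlinarith [sq_nonneg (√n - 2)]
    _ = n * (n + 4) / 4 := by ring

/-- A tangent-line bound for `x ↦ x ^ (3 / 2)`. -/
theorem Real.rpow_three_halves_add_le {m k : ℝ} (hm : 0 ≤ m) (hk : 0 ≤ k) :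
    (m + k) ^ ((3 : ℝ) / 2) ≤ m ^ ((3 : ℝ) / 2) + 3 / 2 * (k * √(m + k)) := by
  rw [Real.rpow_three_halves_eq_sqrt_pow hm, Real.rpow_three_halves_eq_sqrt_pow (by positivity)]
  have hs := Real.sq_sqrt hm
  have ht := Real.sq_sqrt (add_nonneg hm hk)
  have hs0 := Real.sqrt_nonneg m
  have ht0 := Real.sqrt_nonneg (m + k)
  set s := √m
  set t := √(m + k)
  have hk' : k = t ^ 2 - s ^ 2 := by linarith
  rw [hk']
  nlinarith [mul_nonneg (sq_nonneg (t - s)) (by positivity : 0 ≤ t + 2 * s)]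


/-- Let `L : ℕ → ℝ` satisfy `L n = 0` for `n ≤ 3` and, for `n ≥ 4`,
`L n = min_{x + i = n − 2} (x + i(i−1)/2 + L (x + 1))` (the minimum over natural numbers
`x, i` with `x + i = n − 2`, realised by letting `x` range over `{0, …, n − 2}` and taking
`i = n − 2 − x`).  Then `L n ≥ (1/10) · n^{3/2}` for all `n ≥ 4`; in particular
`L ∈ Ω(n^{3/2})`. -/
theorem restricted_lower_bound (L : ℕ → ℝ)
    (h0 : ∀ n, n ≤ 3 → L n = 0)
    (hrec : ∀ n, ∀ _hn : 4 ≤ n, L n =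
      (Finset.range (n - 1)).inf' (Finset.nonempty_range_iff.mpr (by omega))
        (fun x : ℕ => (x : ℝ) +
          ((n - 2 - x : ℕ) : ℝ) * (((n - 2 - x : ℕ) : ℝ) - 1) / 2 + L (x + 1))) :
    ∀ n : ℕ, 4 ≤ n → (1 / 10 : ℝ) * (n : ℝ) ^ ((3 : ℝ) / 2) ≤ L n := by
  intro n
  induction n using Nat.strong_induction_on with
  | _ n ih =>
  intro hn
  rw [hrec n hn, Finset.le_inf'_iff]
  intro x hx
  obtain ⟨i, rfl⟩ : ∃ i, n = x + i + 2 := ⟨n - 2 - x, by grind⟩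
  rw [show x + i + 2 - 2 - x = i by omega]
  by_cases hx3 : x + 1 ≤ 3
  · rw [h0 _ hx3]
    have hbound := Real.rpow_three_halves_le_quadratic (Nat.cast_nonneg (α := ℝ) (x + i + 2))
    have hx2 : x ≤ 2 := by omega
    push_cast at hbound ⊢
    have hxi : (2 : ℝ) ≤ x + i := by exact_mod_cast (by omega : 2 ≤ x + i)
    have hi0 : (0 : ℝ) ≤ i := Nat.cast_nonneg i
    interval_cases x <;> push_cast at hbound hxi ⊢ <;> nlinarith [sq_nonneg ((i : ℝ) - 1)]
  · have hL := ih (x + 1) (by omega) (by omega)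
    have hx3' : (3 : ℝ) ≤ x := by exact_mod_cast (by omega : 3 ≤ x)
    have hi0 : (0 : ℝ) ≤ i := Nat.cast_nonneg i
    have htangent := Real.rpow_three_halves_add_le (m := x + 1) (k := i + 1)
      (by positivity) (by positivity)
    have hsq := Real.sq_sqrt (by positivity : (0 : ℝ) ≤ x + 1 + (i + 1))
    push_cast at hL ⊢
    rw [show (x : ℝ) + i + 2 = x + 1 + (i + 1) by ring]
    nlinarith [sq_nonneg (√((x : ℝ) + 1 + (i + 1)) - (i + 1)), sq_nonneg ((i : ℝ) - 1)]
end

section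
/- The complete graph K_3 admits a gap-[4]-vertex-labelling but admits no gap-[3]-vertex-labelling; that is, the vertex-gap number of K_3 equals 4. -/
/-- The gap-strength of `G`: the least number `l` such that some graph obtained from `G` by
removing `l` edges is gap-vertex-labelable. -/
noncomputable def gapStrength {V : Type*} [Fintype V] (G : SimpleGraph V) : ℕ :=
  sInf {l | ∃ H : SimpleGraph V, H ≤ G ∧ H.edgeSet.ncard + l = G.edgeSet.ncard ∧
    GapVertexLabelable H}

theorem gapColor_eq_of_gapNbhd_eq_pair {V : Type*} [Fintype V] [DecidableEq V]
    {G : SimpleGraph V} {v a b : V} (π : V → ℕ) (hab : a ≠ b) (h : gapNbhd G v = {a, b}) :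
    gapColor G π v = max (π a) (π b) - min (π a) (π b) := by
  have hcard : (gapNbhd G v).card = 2 := h ▸ Finset.card_pair hab
  have himage : (gapNbhd G v).image π = {π a, π b} := by
    rw [h, Finset.image_insert, Finset.image_singleton]
  have hne : ((gapNbhd G v).image π).Nonempty := by simp [himage]
  rw [gapColor, dif_pos hne, if_pos hcard.ge]
  congr 1
  · apply le_antisymm <;> simp [himage]
  · apply le_antisymm <;> simp [himage]

theorem gapNbhd_top {V : Type*} [Fintype V] [DecidableEq V] (v : V) :
    gapNbhd (⊤ : SimpleGraph V) v = Finset.univ.erase v := by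
  ext u
  simp [gapNbhd, eq_comm]

theorem isGapLabelling_top_fin_three_iff {k : ℕ} {π : Fin 3 → ℕ} :
    IsGapLabelling (⊤ : SimpleGraph (Fin 3)) k π ↔
      (∀ v, 1 ≤ π v ∧ π v ≤ k) ∧
        Function.Injective ![max (π 1) (π 2) - min (π 1) (π 2),
          max (π 0) (π 2) - min (π 0) (π 2), max (π 0) (π 1) - min (π 0) (π 1)] := by
  have hcolor : gapColor (⊤ : SimpleGraph (Fin 3)) π =
      ![max (π 1) (π 2) - min (π 1) (π 2),
        max (π 0) (π 2) - min (π 0) (π 2), max (π 0) (π 1) - min (π 0) (π 1)] := by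
    funext v
    fin_cases v
    · exact gapColor_eq_of_gapNbhd_eq_pair π (by decide) ((gapNbhd_top _).trans (by decide))
    · exact gapColor_eq_of_gapNbhd_eq_pair π (by decide) ((gapNbhd_top _).trans (by decide))
    · exact gapColor_eq_of_gapNbhd_eq_pair π (by decide) ((gapNbhd_top _).trans (by decide))
  rw [IsGapLabelling, ← hcolor]
  simp only [SimpleGraph.top_adj, Function.Injective, ne_eq, not_imp_not]

theorem four_le_of_isGapLabelling_top_fin_three {k : ℕ} {π : Fin 3 → ℕ}
    (h : IsGapLabelling (⊤ : SimpleGraph (Fin 3)) k π) : 4 ≤ k := by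
  obtain ⟨hbound, hinj⟩ := isGapLabelling_top_fin_three_iff.mp h
  have h₀ := hbound 0
  have h₁ := hbound 1
  have h₂ := hbound 2
  have h₀₁ := hinj.ne (show (0 : Fin 3) ≠ 1 by decide)
  have h₀₂ := hinj.ne (show (0 : Fin 3) ≠ 2 by decide)
  have h₁₂ := hinj.ne (show (1 : Fin 3) ≠ 2 by decide)
  simp only [Matrix.cons_val] at h₀₁ h₀₂ h₁₂
  omega

theorem isGapLabelling_top_fin_three_four :
    IsGapLabelling (⊤ : SimpleGraph (Fin 3)) 4 ![1, 2, 4] :=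
  isGapLabelling_top_fin_three_iff.mpr ⟨by decide, by decide⟩

/-- `K_3` admits a gap-`[4]`-vertex-labelling but no gap-`[3]`-vertex-labelling; that is, the
vertex-gap number of `K_3` equals `4`. -/
theorem vertexGapNumber_K3 :
    (∃ π, IsGapLabelling (⊤ : SimpleGraph (Fin 3)) 4 π) ∧
      (¬ ∃ π, IsGapLabelling (⊤ : SimpleGraph (Fin 3)) 3 π) ∧
      vertexGapNumber (⊤ : SimpleGraph (Fin 3)) = 4 := by
  refine ⟨⟨_, isGapLabelling_top_fin_three_four⟩, ?_, ?_⟩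
  · rintro ⟨π, hπ⟩
    exact absurd (four_le_of_isGapLabelling_top_fin_three hπ) (by decide)
  · apply IsLeast.csInf_eq
    refine ⟨⟨by decide, _, isGapLabelling_top_fin_three_four⟩, ?_⟩
    rintro k ⟨-, π, hπ⟩
    exact four_le_of_isGapLabelling_top_fin_three hπ
end

section
/- No simple graph on 5 vertices with exactly 9 edges (i.e. no graph obtained from the complete graph K_5 by deleting a single edge) is gap-vertex-labelable. -/
/-- A vertex with at least two neighbours gets the gap of the labels of its neighbours. -/
theorem gapColor_eq_max_sub_min {V : Type*} [Fintype V] {G : SimpleGraph V} {v : V}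
    (h : 2 ≤ (gapNbhd G v).card) (π : V → ℕ) :
    ∃ x ∈ gapNbhd G v, ∃ y ∈ gapNbhd G v, (∀ u ∈ gapNbhd G v, π u ≤ π x ∧ π y ≤ π u) ∧
      gapColor G π v = π x - π y := by
  have hne : (gapNbhd G v).Nonempty := Finset.card_pos.1 (by omega)
  have hne' := hne.image π
  obtain ⟨x, hx, hxm⟩ := Finset.mem_image.1 (Finset.max'_mem _ hne')
  obtain ⟨y, hy, hym⟩ := Finset.mem_image.1 (Finset.min'_mem _ hne')
  refine ⟨x, hx, y, hy, fun u hu => ⟨?_, ?_⟩, ?_⟩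
  · rw [hxm]
    exact Finset.le_max' _ _ (Finset.mem_image_of_mem π hu)
  · rw [hym]
    exact Finset.min'_le _ _ (Finset.mem_image_of_mem π hu)
  · rw [gapColor, dif_pos hne', if_pos h, hxm, hym]

theorem gapColor_eq_of_gapNbhd_eq_three {V : Type*} [Fintype V] [DecidableEq V]
    {G : SimpleGraph V} {v x y z : V} (h : gapNbhd G v = {x, y, z}) (hxy : x ≠ y)
    (π : V → ℕ) :
    gapColor G π v = max (π x) (max (π y) (π z)) - min (π x) (min (π y) (π z)) := by
  have hc : 2 ≤ (gapNbhd G v).card := by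
    rw [← Finset.card_pair hxy, h]
    exact Finset.card_le_card (by grind)
  obtain ⟨p, hp, q, hq, hb, he⟩ := gapColor_eq_max_sub_min hc π
  simp only [h, Finset.mem_insert, Finset.mem_singleton, forall_eq_or_imp, forall_eq] at hp hq hb
  rw [he]
  rcases hp with rfl | rfl | rfl <;> rcases hq with rfl | rfl | rfl <;> omega

theorem gapColor_eq_of_gapNbhd_eq_four {V : Type*} [Fintype V] [DecidableEq V]
    {G : SimpleGraph V} {v w x y z : V} (h : gapNbhd G v = {w, x, y, z}) (hwx : w ≠ x)
    (π : V → ℕ) :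
    gapColor G π v = max (max (π w) (π x)) (max (π y) (π z)) -
      min (min (π w) (π x)) (min (π y) (π z)) := by
  have hc : 2 ≤ (gapNbhd G v).card := by
    rw [← Finset.card_pair hwx, h]
    exact Finset.card_le_card (by grind)
  obtain ⟨p, hp, q, hq, hb, he⟩ := gapColor_eq_max_sub_min hc π
  simp only [h, Finset.mem_insert, Finset.mem_singleton, forall_eq_or_imp, forall_eq] at hp hq hb
  rw [he]
  rcases hp with rfl | rfl | rfl | rfl <;> rcases hq with rfl | rfl | rfl | rfl <;> omega

/-- A graph on five vertices with nine edges misses exactly one edge of the complete graph. -/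
theorem exists_adj_iff_of_ncard_edgeSet_eq_nine (G : SimpleGraph (Fin 5))
    (hG : G.edgeSet.ncard = 9) :
    ∃ a b, a ≠ b ∧ ∀ u v, G.Adj u v ↔ u ≠ v ∧ s(u, v) ≠ s(a, b) := by
  classical
  have htop : (⊤ : SimpleGraph (Fin 5)).edgeSet.ncard = 10 := by
    rw [← SimpleGraph.coe_edgeFinset, Set.ncard_coe_finset,
      SimpleGraph.card_edgeFinset_top_eq_card_choose_two]
    rfl
  have hone : ((⊤ : SimpleGraph (Fin 5)).edgeSet \ G.edgeSet).ncard = 1 := by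
    rw [Set.ncard_sdiff (SimpleGraph.edgeSet_mono le_top), htop, hG]
  obtain ⟨s, hs⟩ := Set.ncard_eq_one.1 hone
  induction s with | h a b =>
  have hmem (u v : Fin 5) : (u ≠ v ∧ ¬ G.Adj u v) ↔ s(u, v) = s(a, b) := by
    simpa using Set.ext_iff.1 hs s(u, v)
  refine ⟨a, b, ((hmem a b).2 rfl).1, fun u v => ?_⟩
  have huv : G.Adj u v → u ≠ v := SimpleGraph.Adj.ne
  have := hmem u v
  tauto

theorem exists_three_others : ∀ a b : Fin 5, a ≠ b → ∃ c d e : Fin 5,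
    c ≠ d ∧ c ≠ e ∧ d ≠ e ∧ a ≠ c ∧ a ≠ d ∧ a ≠ e ∧ b ≠ c ∧ b ≠ d ∧ b ≠ e ∧
      ∀ x, x = a ∨ x = b ∨ x = c ∨ x = d ∨ x = e := by
  decide

/-- No simple graph on `5` vertices with exactly `9` edges (i.e. no graph obtained from `K_5`
by deleting a single edge) is gap-vertex-labelable. -/
theorem K5_minus_one_edge_not_gapVertexLabelable (G : SimpleGraph (Fin 5))
    (hG : G.edgeSet.ncard = 9) : ¬ GapVertexLabelable G := by
  rintro ⟨k, -, π, -, hπ⟩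
  obtain ⟨a, b, hab, hadj⟩ := exists_adj_iff_of_ncard_edgeSet_eq_nine G hG
  obtain ⟨c, d, e, hcd, hce, hde, hac, had, hae, hbc, hbd, hbe, hall⟩ :=
    exists_three_others a b hab
  have hmem (v u : Fin 5) : u ∈ gapNbhd G v ↔ v ≠ u ∧ s(v, u) ≠ s(a, b) := by
    simp [gapNbhd, hadj]
  have ha : gapNbhd G a = {c, d, e} := by
    ext x; rw [hmem]; have := hall x; simp; grind
  have hc : gapNbhd G c = {a, b, d, e} := by
    ext x; rw [hmem]; have := hall x; simp; grind
  have hd : gapNbhd G d = {a, b, c, e} := by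
    ext x; rw [hmem]; have := hall x; simp; grind
  have he : gapNbhd G e = {a, b, c, d} := by
    ext x; rw [hmem]; have := hall x; simp; grind
  have key (u v : Fin 5) (huv : u ≠ v) (hs : s(u, v) ≠ s(a, b)) :=
    hπ u v ((hadj u v).2 ⟨huv, hs⟩)
  have h1 := key a c hac (by simp; grind)
  have h2 := key a d had (by simp; grind)
  have h3 := key a e hae (by simp; grind)
  have h4 := key c d hcd (by simp; grind)
  have h5 := key c e hce (by simp; grind)
  have h6 := key d e hde (by simp; grind)
  simp only [gapColor_eq_of_gapNbhd_eq_three ha hcd, gapColor_eq_of_gapNbhd_eq_four hc hab,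
    gapColor_eq_of_gapNbhd_eq_four hd hab, gapColor_eq_of_gapNbhd_eq_four he hab]
    at h1 h2 h3 h4 h5 h6
  clear key hmem hadj hπ hall
  generalize π a = A, π b = B, π c = C, π d = D, π e = E at *
  rcases le_total C D with _ | _ <;> rcases le_total D E with _ | _ <;>
    rcases le_total C E with _ | _ <;> rcases le_total A B with _ | _ <;> grind
end

section
/- Let f' : ℕ → ℝ be defined by f'(n) = 0 for n ≤ 3 and, for n ≥ 4, f'(n) = (n − ⌊√n⌋ − 2) + ⌊√n⌋(⌊√n⌋ − 1)/2 + f'(n − ⌊√n⌋ − 1). Then f'(n) ≤ 3·n·√n for all n ∈ ℕ. -/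
/-- Let `f' : ℕ → ℝ` satisfy `f' n = 0` for `n ≤ 3` and, for `n ≥ 4`,
`f' n = (n − ⌊√n⌋ − 2) + ⌊√n⌋(⌊√n⌋ − 1)/2 + f' (n − ⌊√n⌋ − 1)`.
Then `f' n ≤ 3 · n · √n` for all `n : ℕ`. -/
theorem removal_upper_bound (f : ℕ → ℝ)
    (h0 : ∀ n, n ≤ 3 → f n = 0)
    (hrec : ∀ n : ℕ, 4 ≤ n → f n =
      ((n - Nat.sqrt n - 2 : ℕ) : ℝ) +
        ((Nat.sqrt n : ℝ) * ((Nat.sqrt n : ℝ) - 1)) / 2 +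
        f (n - Nat.sqrt n - 1)) :
    ∀ n : ℕ, f n ≤ 3 * (n : ℝ) * Real.sqrt n := by
  intro n
  induction n using Nat.strong_induction_on with
  | _ n ih =>
    rcases Nat.lt_or_ge n 4 with hn | hn
    · rw [h0 n (by omega)]
      positivity
    · have hs_sq : Nat.sqrt n * Nat.sqrt n ≤ n := Nat.sqrt_le n
      have hs_two : 2 ≤ Nat.sqrt n := Nat.le_sqrt.mpr (by omega)
      have hs_le : Nat.sqrt n + 2 ≤ n := by nlinarith
      have ih' := ih (n - Nat.sqrt n - 1) (by omega)
      rw [hrec n hn]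
      have hm : ((n - Nat.sqrt n - 1 : ℕ) : ℝ) = n - Nat.sqrt n - 1 := by
        rw [Nat.sub_sub, Nat.cast_sub (by omega)]
        push_cast
        ring
      have hc : ((n - Nat.sqrt n - 2 : ℕ) : ℝ) = n - Nat.sqrt n - 2 := by
        rw [Nat.sub_sub, Nat.cast_sub (by omega)]
        push_cast
        ring
      have hmono : √((n - Nat.sqrt n - 1 : ℕ) : ℝ) ≤ √(n : ℝ) :=
        Real.sqrt_le_sqrt (by exact_mod_cast (by omega : n - Nat.sqrt n - 1 ≤ n))
      have hmul := mul_le_mul_of_nonneg_left hmono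
        (by positivity : (0 : ℝ) ≤ 3 * ((n - Nat.sqrt n - 1 : ℕ) : ℝ))
      have hle := ih'.trans hmul
      rw [hm] at hle
      rw [hc]
      have hx_sq : √(n : ℝ) * √(n : ℝ) = n := Real.mul_self_sqrt n.cast_nonneg
      have hx_lt : √(n : ℝ) ≤ Nat.sqrt n + 1 := Real.real_sqrt_le_nat_sqrt_succ
      have hprod := mul_le_mul_of_nonneg_right hx_lt (Real.sqrt_nonneg (n : ℝ))
      have hs_sq' : (Nat.sqrt n : ℝ) * Nat.sqrt n ≤ n := by exact_mod_cast hs_sq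
      have hs_nonneg : (0 : ℝ) ≤ Nat.sqrt n := Nat.cast_nonneg _
      have hn_nonneg : (0 : ℝ) ≤ n := Nat.cast_nonneg _
      linarith
end

section
/- For real numbers n and x, let g(n, x) = x + (n − x − 2)(n − x − 3)/2 + (1/10)(x + 1)^{3/2}, and for n ≥ 3 let x₁(n) = (800n − 2791 − 3√(1600n − 3991))/800. Then for every real n ≥ 3 and every real x ≥ −1, g(n, x) ≥ g(n, x₁(n)); that is, x₁(n) is a global minimum point of x ↦ g(n, x) on [−1, ∞). -/
noncomputable section

/-- `g n x = x + (n − x − 2)(n − x − 3)/2 + (1/10)(x + 1)^{3/2}`. -/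
def g (n x : ℝ) : ℝ :=
  x + (n - x - 2) * (n - x - 3) / 2 + (1 / 10) * (x + 1) ^ ((3 : ℝ) / 2)

/-- `x₁ n = (800n − 2791 − 3√(1600n − 3991))/800`. -/
def x₁ (n : ℝ) : ℝ :=
  (800 * n - 2791 - 3 * Real.sqrt (1600 * n - 3991)) / 800

/-- In the variable `u = √(x + 1)`, the function `g n` is a quartic polynomial. -/
theorem g_sq_sub_one (n : ℝ) {u : ℝ} (hu : 0 ≤ u) :
    g n (u ^ 2 - 1) =
      u ^ 2 - 1 + (n - u ^ 2 - 1) * (n - u ^ 2 - 2) / 2 + (1 / 10) * u ^ 3 := by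
  have h : (u ^ 2) ^ ((3 : ℝ) / 2) = u ^ 3 := by
    rw [← Real.rpow_natCast u 2, ← Real.rpow_mul hu, ← Real.rpow_natCast u 3]
    norm_num
  rw [g, sub_add_cancel, h]
  ring

/-- For every real `n ≥ 3` and every real `x ≥ −1`, `g n x ≥ g n (x₁ n)`; that is, `x₁ n` is
a global minimum point of `x ↦ g n x` on `[−1, ∞)`. -/
theorem g_global_min (n x : ℝ) (hn : 3 ≤ n) (hx : -1 ≤ x) : g n (x₁ n) ≤ g n x := by
  obtain ⟨u, hu, rfl⟩ : ∃ u : ℝ, 0 ≤ u ∧ x = u ^ 2 - 1 :=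
    ⟨√(x + 1), Real.sqrt_nonneg _, by rw [Real.sq_sqrt (by linarith)]; ring⟩
  have hs : √(1600 * n - 3991) ^ 2 = 1600 * n - 3991 := Real.sq_sqrt (by linarith)
  obtain ⟨v, hv⟩ : ∃ v : ℝ, √(1600 * n - 3991) = 40 * v + 3 :=
    ⟨(√(1600 * n - 3991) - 3) / 40, by ring⟩
  have hv0 : 0 ≤ v := by
    have : 3 ≤ √(1600 * n - 3991) := Real.le_sqrt_of_sq_le (by linarith)
    linarith
  rw [hv] at hs
  have hn_eq : n = v ^ 2 + 3 / 20 * v + 5 / 2 := by linarith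
  have hx₁ : x₁ n = v ^ 2 - 1 := by
    rw [x₁, hv, hn_eq]
    ring
  rw [hx₁, g_sq_sub_one n hu, g_sq_sub_one n hv0, ← sub_nonneg]
  have hnonneg : 0 ≤ (u ^ 2 - v ^ 2) ^ 2 / 2 + (u - v) ^ 2 * (u / 10 + v / 20) := by positivity
  convert hnonneg using 1
  rw [hn_eq]
  ring

end
end

section
/- For real n ≥ 3, let g(n, x) = x + (n − x − 2)(n − x − 3)/2 + (1/10)(x + 1)^{3/2}, let x₁(n) = (800n − 2791 − 3√(1600n − 3991))/800, and define h(n) = g(n, x₁(n)) − (1/10)·n^{3/2}. Then h(n) ≥ 0 for all real n ≥ 4, and h is nondecreasing on [4, ∞), i.e. h(m) ≤ h(n) whenever 4 ≤ m ≤ n. -/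
noncomputable section

/-- `h n = g n (x₁ n) − (1/10) n^{3/2}`. -/
def hFun (n : ℝ) : ℝ := g n (x₁ n) - (1 / 10) * n ^ ((3 : ℝ) / 2)

theorem rpow_three_halves_sq {a : ℝ} (ha : 0 ≤ a) : (a ^ 2) ^ ((3 : ℝ) / 2) = a ^ 3 := by
  rw [← Real.rpow_natCast, ← Real.rpow_mul ha, ← Real.rpow_natCast]
  norm_num

/-- Parametrization of `hFun` by `s = √(x₁ n + 1)` and `q = √n`. -/
theorem exists_hFun_eq {n : ℝ} (hn : 4 ≤ n) :
    ∃ s q : ℝ, 23 / 20 ≤ s ∧ 0 < q ∧ q ^ 2 = n ∧ n = s ^ 2 + 3 / 20 * s + 5 / 2 ∧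
      q ≤ s + 1 ∧
      hFun n = s ^ 3 / 10 + 809 / 800 * s ^ 2 + 3 / 20 * s - 5 / 8 - q ^ 3 / 10 := by
  have hr : √(1600 * n - 3991) ^ 2 = 1600 * n - 3991 := Real.sq_sqrt (by linarith)
  have hr49 : 49 ≤ √(1600 * n - 3991) := Real.le_sqrt_of_sq_le (by linarith)
  obtain ⟨s, hs⟩ : ∃ s, √(1600 * n - 3991) = 40 * s + 3 :=
    ⟨(√(1600 * n - 3991) - 3) / 40, by ring⟩
  rw [hs] at hr hr49
  have hs' : 23 / 20 ≤ s := by linarith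
  have hns : n = s ^ 2 + 3 / 20 * s + 5 / 2 := by linarith
  have hq : √n ^ 2 = n := Real.sq_sqrt (by linarith)
  refine ⟨s, √n, hs', Real.sqrt_pos.2 (by linarith), hq, hns, ?_, ?_⟩
  · exact Real.sqrt_le_iff.2 ⟨by linarith, by linarith⟩
  · have hx : x₁ n = s ^ 2 - 1 := by
      rw [x₁, hs]
      linarith
    have hn32 : n ^ ((3 : ℝ) / 2) = √n ^ 3 := by
      rw [← rpow_three_halves_sq (Real.sqrt_nonneg n), hq]
    rw [hFun, g, hx, hn32, sub_add_cancel, rpow_three_halves_sq (by linarith), hns]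
    ring

/-- The chord slope `(q³ - p³) / (q² - p²)` is monotone in both arguments. -/
theorem chord_slope_mono {p q P Q : ℝ} (hp : 0 ≤ p) (hq : 0 ≤ q) (hP : p ≤ P) (hQ : q ≤ Q) :
    (q ^ 2 + q * p + p ^ 2) * (Q + P) ≤ (Q ^ 2 + Q * P + P ^ 2) * (q + p) := by
  obtain ⟨a, ha, rfl⟩ : ∃ a, 0 ≤ a ∧ Q = q + a := ⟨Q - q, by linarith, by ring⟩
  obtain ⟨b, hb, rfl⟩ : ∃ b, 0 ≤ b ∧ P = p + b := ⟨P - p, by linarith, by ring⟩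
  rw [← sub_nonneg]
  ring_nf
  positivity

/-- `h n ≥ 0` for all real `n ≥ 4`, and `h` is nondecreasing on `[4, ∞)`. -/
theorem hFun_nonneg_and_monotone :
    (∀ n : ℝ, 4 ≤ n → 0 ≤ hFun n) ∧
      (∀ m n : ℝ, 4 ≤ m → m ≤ n → hFun m ≤ hFun n) := by
  refine ⟨fun n hn => ?_, fun m n hm hmn => ?_⟩
  · obtain ⟨s, q, hs, hq, -, -, hqs, h⟩ := exists_hFun_eq hn
    have hcube : q ^ 3 ≤ (s + 1) ^ 3 := pow_le_pow_left₀ hq.le hqs 3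
    rw [h]
    nlinarith [mul_self_nonneg (s - 23 / 20)]
  · obtain ⟨s, p, hs, hp, hpm, hms, hps, h⟩ := exists_hFun_eq hm
    obtain ⟨t, q, ht, hq, hqn, hnt, hqt, h'⟩ := exists_hFun_eq (hm.trans hmn)
    have hst : s ≤ t := by nlinarith
    have hslope := chord_slope_mono hp.le hq.le hps hqt
    have hsq : q ^ 2 - p ^ 2 ≤ (t - s) * (t + 1 + (s + 1)) := by nlinarith
    have hcube : q ^ 3 - p ^ 3 ≤
        (t - s) * ((t + 1) ^ 2 + (t + 1) * (s + 1) + (s + 1) ^ 2) := by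
      refine le_of_mul_le_mul_right ?_ (add_pos hq hp)
      calc (q ^ 3 - p ^ 3) * (q + p)
          = (q ^ 2 - p ^ 2) * (q ^ 2 + q * p + p ^ 2) := by ring
        _ ≤ (t - s) * (t + 1 + (s + 1)) * (q ^ 2 + q * p + p ^ 2) := by gcongr
        _ = (t - s) * ((q ^ 2 + q * p + p ^ 2) * (t + 1 + (s + 1))) := by ring
        _ ≤ (t - s) * (((t + 1) ^ 2 + (t + 1) * (s + 1) + (s + 1) ^ 2) * (q + p)) :=
          mul_le_mul_of_nonneg_left hslope (sub_nonneg.2 hst)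
        _ = _ := by ring
    rw [h, h']
    nlinarith [mul_nonneg (sub_nonneg.2 hst) (by linarith : 0 ≤ t + s - 1)]

end
end

section
/- For every real q ≥ 6, setting z = q³ − 3·(3/10)^{2/3}·q^{12/5}, one has 2z + (3/100)·z^{6/5} ≥ (3/100)·q^{18/5}. -/
/-- Bernoulli's inequality for the exponent `6 / 5`, in homogeneous form. -/
theorem le_rpow_six_fifths {t c : ℝ} (ht : 0 < t) (hct : c ≤ t) :
    t ^ 6 - 6 / 5 * c * t ^ 5 ≤ (t ^ 5 - c * t ^ 4) ^ ((6 : ℝ) / 5) := by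
  have hs : -1 ≤ -(c / t) := neg_le_neg ((div_le_one ht).2 hct)
  have hb := one_add_mul_self_le_rpow_one_add hs (p := 6 / 5) (by norm_num)
  have hz : t ^ 5 - c * t ^ 4 = t ^ 5 * (1 + -(c / t)) := by field_simp; ring
  have hp : (t ^ 5) ^ ((6 : ℝ) / 5) = t ^ 6 := by
    rw [← Real.rpow_natCast, ← Real.rpow_mul ht.le, ← Real.rpow_natCast]
    norm_num
  rw [hz, Real.mul_rpow (by positivity) (by linarith), hp]
  calc t ^ 6 - 6 / 5 * c * t ^ 5 = t ^ 6 * (1 + 6 / 5 * -(c / t)) := by field_simp; ring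
    _ ≤ _ := by gcongr

/-- For every real `q ≥ 6`, setting `z = q³ − 3·(3/10)^{2/3}·q^{12/5}`, one has
`2z + (3/100)·z^{6/5} ≥ (3/100)·q^{18/5}`. -/
theorem lower_bound_z_part (q : ℝ) (hq : 6 ≤ q) :
    (3 / 100 : ℝ) * q ^ ((18 : ℝ) / 5) ≤
      2 * (q ^ (3 : ℕ) - 3 * (3 / 10 : ℝ) ^ ((2 : ℝ) / 3) * q ^ ((12 : ℝ) / 5)) +
        (3 / 100) *
          (q ^ (3 : ℕ) - 3 * (3 / 10 : ℝ) ^ ((2 : ℝ) / 3) * q ^ ((12 : ℝ) / 5)) ^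
            ((6 : ℝ) / 5) := by
  have hq0 : 0 ≤ q := by linarith
  set a : ℝ := (3 / 10 : ℝ) ^ ((2 : ℝ) / 3) with ha
  have ha3 : a ^ 3 = 9 / 100 := by
    rw [ha, ← Real.rpow_natCast, ← Real.rpow_mul (by norm_num)]
    norm_num
  have ha2 : a ≤ 1 / 2 := le_of_pow_le_pow_left₀ three_ne_zero (by norm_num) (by rw [ha3]; norm_num)
  obtain ⟨t, ht⟩ : ∃ t, t = q ^ ((3 : ℝ) / 5) := ⟨_, rfl⟩
  have ht0 : 0 ≤ t := ht ▸ Real.rpow_nonneg hq0 _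
  have hpow (n : ℕ) : q ^ ((3 : ℝ) / 5 * n) = t ^ n := by
    rw [Real.rpow_mul hq0, Real.rpow_natCast, ht]
  have h3 : q ^ 3 = t ^ 5 := by
    rw [← hpow, ← Real.rpow_natCast]
    norm_num
  have h12 : q ^ ((12 : ℝ) / 5) = t ^ 4 := by
    rw [← hpow]
    norm_num
  have h18 : q ^ ((18 : ℝ) / 5) = t ^ 6 := by
    rw [← hpow]
    norm_num
  have ht2 : 2 ≤ t := by
    refine le_of_pow_le_pow_left₀ (n := 5) (by norm_num) ht0 ?_
    rw [← h3]
    calc (2 : ℝ) ^ 5 ≤ 6 ^ 3 := by norm_num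
      _ ≤ q ^ 3 := by gcongr
  have hb := le_rpow_six_fifths (t := t) (c := 3 * a) (by linarith) (by linarith)
  rw [h3, h12, h18]
  have hlin : 0 ≤ 2 * t - 6 * a - 27 / 250 * a * t := by nlinarith
  have hmul := mul_nonneg (pow_nonneg ht0 4) hlin
  linarith
end
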